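/- Define Laurent polynomials Q_n, R_n in y over ℂ[u^{−1}] recursively by Q_0 = 1, R_0 = 0, Q_{n+1} = u^{−2} y³ ∂_y Q_n + y^{−2} R_n, and R_{n+1} = Q_n + u^{−2} y³ ∂_y R_n. Then for every n ≥ 0 the identity S_y^n A = Q_n · A + R_n · y^{−1} B holds as formal Laurent series in y over K, where B := y · S_y A. -/

import Mathlib

noncomputable section

/-- The base field `K = ℂ(u)`, rational functions in the variable `u`. -/
abbrev K : Type := RatFunc ℂ

/-- The variable `u ∈ K`. -/
def u : K := RatFunc.X

/-- The formal derivative `∂_y` of a formal Laurent series in `y` over `K`. -/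
def derivLS (f : LaurentSeries K) : LaurentSeries K where
  coeff := fun n => ((n + 1 : ℤ) : K) * f.coeff (n + 1)
  isPWO_support' := by
    refine ((f.isPWO_support.add (Set.isPWO_singleton (-1 : ℤ))).mono ?_)
    intro n hn
    simp only [Function.mem_support, ne_eq] at hn
    have hf : f.coeff (n + 1) ≠ 0 := fun h => hn (by simp [h])
    rw [Set.add_singleton]
    exact ⟨n + 1, by simpa [HahnSeries.mem_support] using hf, by ring⟩

/-- Multiplication of a formal Laurent series by `y^k`. -/
def ySh (k : ℤ) (f : LaurentSeries K) : LaurentSeries K :=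
  (HahnSeries.single k (1 : K)) * f

/-- The operator `S_y f = u⁻² y³ ∂_y f + (1/2) u⁻² y² f + y⁻¹ f`. -/
def Sy (f : LaurentSeries K) : LaurentSeries K :=
  (u⁻¹ ^ 2) • ySh 3 (derivLS f) + ((1 / 2 : K) * u⁻¹ ^ 2) • ySh 2 f + ySh (-1) f

/-- `a_n = (-1)^n (6n)! / (288^n (2n)! (3n)!)`. -/
def aQ (n : ℕ) : ℚ :=
  (-1) ^ n * ((6 * n).factorial : ℚ) /
    (288 ^ n * ((2 * n).factorial : ℚ) * ((3 * n).factorial : ℚ))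

/-- The power-series-in-`y` `Σ_{n ≥ 0} c_n u^{-2n} y^{3n}` (viewed as a Laurent series)
attached to rational coefficients `c : ℕ → ℚ`. -/
def mkS (c : ℕ → ℚ) : LaurentSeries K :=
  HahnSeries.ofPowerSeries ℤ K
    (PowerSeries.mk fun m => if 3 ∣ m then ((c (m / 3) : ℚ) : K) * u⁻¹ ^ (2 * (m / 3)) else 0)

/-- The series `A = Σ_{n ≥ 0} a_n u^{-2n} y^{3n}`. -/
def A : LaurentSeries K := mkS aQ

/-- The pairs `(Q_n, R_n)` defined recursively by `Q_0 = 1`, `R_0 = 0`,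
`Q_{n+1} = u⁻² y³ ∂_y Q_n + y⁻² R_n`, `R_{n+1} = Q_n + u⁻² y³ ∂_y R_n`. -/
def QR : ℕ → LaurentSeries K × LaurentSeries K
  | 0 => (1, 0)
  | n + 1 =>
    ((u⁻¹ ^ 2) • ySh 3 (derivLS (QR n).1) + ySh (-2) (QR n).2,
     (QR n).1 + (u⁻¹ ^ 2) • ySh 3 (derivLS (QR n).2))

/-- The series `B := y · S_y A`. -/
def B : LaurentSeries K := ySh 1 (Sy A)

theorem coeff_ySh (k : ℤ) (f : LaurentSeries K) (n : ℤ) :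
    (ySh k f).coeff n = f.coeff (n - k) := by
  have h := HahnSeries.coeff_single_mul_add (r := (1 : K)) (x := f) (a := n - k) (b := k)
  simpa [ySh] using h

theorem ySh_ySh (k l : ℤ) (f : LaurentSeries K) : ySh k (ySh l f) = ySh (k + l) f := by
  ext n
  simp only [coeff_ySh]
  congr 1
  ring

theorem ySh_zero (f : LaurentSeries K) : ySh 0 f = f := by
  ext n
  simp [coeff_ySh]

theorem coeff_derivLS (f : LaurentSeries K) (n : ℤ) :
    (derivLS f).coeff n = ((n + 1 : ℤ) : K) * f.coeff (n + 1) :=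
  rfl

/-- The Euler operator `y ∂_y` multiplies the coefficient of `y ^ n` by `n`. -/
theorem coeff_euler (f : LaurentSeries K) (n : ℤ) :
    (ySh 1 (derivLS f)).coeff n = (n : K) * f.coeff n := by
  rw [coeff_ySh, coeff_derivLS, sub_add_cancel]

theorem euler_mul (f g : LaurentSeries K) :
    ySh 1 (derivLS (f * g)) = ySh 1 (derivLS f) * g + f * ySh 1 (derivLS g) := by
  have hsupp (h : LaurentSeries K) : (ySh 1 (derivLS h)).support ⊆ h.support := by
    intro n hn
    rw [HahnSeries.mem_support, coeff_euler] at hn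
    exact right_ne_zero_of_mul hn
  ext n
  rw [HahnSeries.coeff_add, HahnSeries.coeff_mul_left' f.isPWO_support (hsupp f),
    HahnSeries.coeff_mul_right' g.isPWO_support (hsupp g), coeff_euler,
    HahnSeries.coeff_mul, Finset.mul_sum, ← Finset.sum_add_distrib]
  refine Finset.sum_congr rfl fun ij hij => ?_
  rw [coeff_euler, coeff_euler,
    ← (Finset.mem_antidiagonal.mp hij).2.2]
  push_cast
  ring

theorem ySh_mul (k : ℤ) (f g : LaurentSeries K) : ySh k (f * g) = ySh k f * g :=
  (mul_assoc _ _ _).symm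

theorem mul_ySh (k : ℤ) (f g : LaurentSeries K) : f * ySh k g = ySh k (f * g) :=
  mul_left_comm _ _ _

theorem ySh_add (k : ℤ) (f g : LaurentSeries K) : ySh k (f + g) = ySh k f + ySh k g :=
  mul_add _ _ _

theorem ySh_derivLS_mul (f g : LaurentSeries K) :
    ySh 3 (derivLS (f * g)) = ySh 3 (derivLS f) * g + f * ySh 3 (derivLS g) := by
  have h := congrArg (ySh 2) (euler_mul f g)
  rwa [ySh_add, ySh_mul, ← mul_ySh, ySh_ySh, ySh_ySh, ySh_ySh] at h

theorem derivLS_add (f g : LaurentSeries K) : derivLS (f + g) = derivLS f + derivLS g := by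
  ext n
  exact mul_add _ _ _

theorem Sy_add (f g : LaurentSeries K) : Sy (f + g) = Sy f + Sy g := by
  simp only [Sy, derivLS_add, ySh_add, smul_add]
  abel

theorem Sy_mul (f g : LaurentSeries K) :
    Sy (f * g) = (u⁻¹ ^ 2) • ySh 3 (derivLS f) * g + f * Sy g := by
  simp only [Sy, ySh_derivLS_mul]
  simp only [← HahnSeries.C_mul_eq_smul, ySh]
  ring

theorem aQ_succ (n : ℕ) :
    24 * ((n : ℚ) + 1) * aQ (n + 1) = -((6 * n + 1) * (6 * n + 5) * aQ n) := by
  have h2 : ((2 * n).factorial : ℚ) ≠ 0 := by positivity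
  have h3 : ((3 * n).factorial : ℚ) ≠ 0 := by positivity
  simp only [aQ, show 6 * (n + 1) = 6 * n + 5 + 1 by ring, show 2 * (n + 1) = 2 * n + 1 + 1 by ring,
    show 3 * (n + 1) = 3 * n + 2 + 1 by ring, Nat.factorial_succ]
  push_cast
  field_simp
  ring

theorem coeff_mkS_neg (c : ℕ → ℚ) {n : ℤ} (hn : n < 0) : (mkS c).coeff n = 0 := by
  simpa [mkS, hn] using PowerSeries.coeff_coe (PowerSeries.mk fun m =>
    if 3 ∣ m then ((c (m / 3) : ℚ) : K) * u⁻¹ ^ (2 * (m / 3)) else 0) n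

theorem coeff_mkS_natCast (c : ℕ → ℚ) (m : ℕ) : (mkS c).coeff m =
    if 3 ∣ m then ((c (m / 3) : ℚ) : K) * u⁻¹ ^ (2 * (m / 3)) else 0 := by
  rw [mkS, HahnSeries.ofPowerSeries_apply_coeff, PowerSeries.coeff_mk]

/-- The recurrence on coefficients equivalent to the differential equation satisfied by `A`. -/
theorem coeff_A_add_three (m : ℤ) :
    2 * ((m : K) + 3) * A.coeff (m + 3) =
      -(u⁻¹ ^ 2 * (((m : K) + 1 / 2) * ((m : K) + 5 / 2)) * A.coeff m) := by
  rcases lt_or_ge m 0 with hm | hm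
  · rw [A, coeff_mkS_neg _ hm]
    rcases lt_or_ge (m + 3) 0 with h | h
    · rw [coeff_mkS_neg _ h]
      simp
    · obtain ⟨k, hk⟩ := Int.eq_ofNat_of_zero_le h
      rw [hk, coeff_mkS_natCast]
      split_ifs with hd
      · obtain rfl : m = -3 := by lia
        simp
      · simp
  · lift m to ℕ using hm
    rw [A, show (m : ℤ) + 3 = ((m + 3 : ℕ) : ℤ) by push_cast; rfl, coeff_mkS_natCast,
      coeff_mkS_natCast]
    by_cases hd : 3 ∣ m
    · obtain ⟨n, rfl⟩ := hd
      have h := congrArg (fun q : ℚ => (q : K)) (aQ_succ n)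
      push_cast at h
      rw [if_pos (by lia), if_pos (by lia), show (3 * n + 3) / 3 = n + 1 by lia,
        show 3 * n / 3 = n by lia]
      push_cast
      linear_combination (u⁻¹ ^ (2 * n + 2) / 4) * h
    · rw [if_neg (by lia), if_neg hd]
      simp

theorem Sy_Sy_A : Sy (Sy A) = ySh (-2) A := by
  ext n
  have h := coeff_A_add_three (n - 4)
  simp only [Sy, HahnSeries.coeff_add, HahnSeries.coeff_smul, coeff_derivLS, coeff_ySh,
    smul_eq_mul]
  ring_nf at h ⊢
  push_cast at h ⊢
  linear_combination u⁻¹ ^ 2 * h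

/-- For every `n ≥ 0` one has `S_y^n A = Q_n · A + R_n · y⁻¹ B` as formal Laurent series. -/
theorem stmt8 (n : ℕ) :
    Sy^[n] A = (QR n).1 * A + (QR n).2 * ySh (-1) B := by
  have hB : ySh (-1) B = Sy A := by rw [B, ySh_ySh, neg_add_cancel, ySh_zero]
  rw [hB]
  induction n with
  | zero => simp [QR]
  | succ n ih =>
    rw [Function.iterate_succ_apply', ih, Sy_add, Sy_mul, Sy_mul, Sy_Sy_A, mul_ySh, QR, add_mul,
      add_mul, ← ySh_mul]
    abel

end
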